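/- Let H be a real Hilbert space and g : H → ℝ a convex Fréchet differentiable function whose gradient ∇g is L_g-Lipschitz continuous (L_g > 0). Then for every s with 0 < s ≤ 1/L_g and all x, y ∈ H: g(y − s∇g(y)) ≤ g(x) + ⟨∇g(y), y − x⟩ − (s/2)‖∇g(y)‖² − (s/2)‖∇g(y) − ∇g(x)‖². -/

import Mathlib

open Filter Topology
open scoped RealInnerProductSpace

section Gradient

variable {H : Type*} [NormedAddCommGroup H] [InnerProductSpace ℝ H] [CompleteSpace H]
  {g : H → ℝ} {g' : H → H}

/-- The derivative of a function along a line, in terms of its gradient. -/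
theorem HasGradientAt.hasDerivAt_comp_add_smul {u w a : H} {t : ℝ}
    (h : HasGradientAt g a (u + t • w)) :
    HasDerivAt (fun r : ℝ => g (u + r • w)) ⟪a, w⟫ t := by
  have hline : HasDerivAt (fun r : ℝ => u + r • w) w t := by
    simpa using ((hasDerivAt_id t).smul_const w).const_add u
  simpa [Function.comp_def] using h.hasFDerivAt.comp_hasDerivAt t hline

/-- A convex function lies above its tangent planes. -/
theorem ConvexOn.add_inner_gradient_le {a u : H} (hg : ConvexOn ℝ Set.univ g)
    (h : HasGradientAt g a u) (v : H) : g u + ⟪a, v - u⟫ ≤ g v := by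
  have hconv : ConvexOn ℝ Set.univ (fun r : ℝ => g (u + r • (v - u))) := by
    have := hg.comp_affineMap (AffineMap.lineMap (k := ℝ) u v)
    simpa [Function.comp_def, AffineMap.lineMap_apply, add_comm] using this
  have hderiv : HasDerivAt (fun r : ℝ => g (u + r • (v - u))) ⟪a, v - u⟫ 0 :=
    HasGradientAt.hasDerivAt_comp_add_smul (by simpa using h)
  have := hconv.le_slope_of_hasDerivAt (Set.mem_univ 0) (Set.mem_univ 1) one_pos hderiv
  simp [slope_def_field] at this
  linarith

/-- The descent lemma for functions with Lipschitz gradient. -/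
theorem le_add_inner_add_of_lipschitz_gradient {L : ℝ}
    (hg : ∀ u, HasGradientAt g (g' u) u)
    (hlip : ∀ u v, ‖g' u - g' v‖ ≤ L * ‖u - v‖) (u w : H) :
    g (u + w) ≤ g u + ⟪g' u, w⟫ + L / 2 * ‖w‖ ^ 2 := by
  have hderiv (t : ℝ) : HasDerivAt
      (fun r : ℝ => g (u + r • w) - r * ⟪g' u, w⟫ - r ^ 2 * (L / 2 * ‖w‖ ^ 2))
      (⟪g' (u + t • w), w⟫ - ⟪g' u, w⟫ - 2 * t * (L / 2 * ‖w‖ ^ 2)) t := by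
    have := ((hg (u + t • w)).hasDerivAt_comp_add_smul.sub
      ((hasDerivAt_id t).mul_const ⟪g' u, w⟫)).sub
      ((hasDerivAt_pow 2 t).mul_const (L / 2 * ‖w‖ ^ 2))
    simpa using! this
  have hanti : AntitoneOn
      (fun r : ℝ => g (u + r • w) - r * ⟪g' u, w⟫ - r ^ 2 * (L / 2 * ‖w‖ ^ 2))
      (Set.Ici 0) := by
    refine antitoneOn_of_hasDerivWithinAt_nonpos (convex_Ici 0)
      (fun t _ => (hderiv t).continuousAt.continuousWithinAt)
      (fun t _ => (hderiv t).hasDerivWithinAt) fun t ht => ?_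
    have ht : 0 < t := by simpa using ht
    have hnorm : ‖g' (u + t • w) - g' u‖ ≤ L * (t * ‖w‖) := by
      simpa [norm_smul, abs_of_pos ht] using hlip (u + t • w) u
    have hinner := real_inner_le_norm (g' (u + t • w) - g' u) w
    rw [inner_sub_left] at hinner
    nlinarith [mul_le_mul_of_nonneg_right hnorm (norm_nonneg w)]
  have := hanti (Set.mem_Ici.2 le_rfl) (Set.mem_Ici.2 zero_le_one) zero_le_one
  simp at this
  linarith

end Gradient

/-- Modified descent lemma for `0 < s ≤ 1/L_g`:
`g(y − s∇g(y)) ≤ g(x) + ⟨∇g(y), y − x⟩ − (s/2)‖∇g(y)‖² − (s/2)‖∇g(y) − ∇g(x)‖²`. -/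
theorem modified_descent_lemma_small_step
    {H : Type*} [NormedAddCommGroup H] [InnerProductSpace ℝ H] [CompleteSpace H]
    (g : H → ℝ) (g' : H → H) (Lg : ℝ) (hLg : 0 < Lg)
    (hg_convex : ConvexOn ℝ Set.univ g)
    (hg_diff : ∀ u : H, HasGradientAt g (g' u) u)
    (hg_lip : ∀ u v : H, ‖g' u - g' v‖ ≤ Lg * ‖u - v‖)
    (s : ℝ) (hs : 0 < s) (hs' : s ≤ 1 / Lg) (x y : H) :
    g (y - s • g' y) ≤ g x + ⟪g' y, y - x⟫ - s / 2 * ‖g' y‖ ^ 2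
      - s / 2 * ‖g' y - g' x‖ ^ 2 := by
  have hsL : s * Lg ≤ 1 := (le_div_iff₀ hLg).1 hs'
  have hstep (u d : H) :
      g (u + s • d) ≤ g u + s * ⟪g' u, d⟫ + s / 2 * ‖d‖ ^ 2 := by
    have h := le_add_inner_add_of_lipschitz_gradient hg_diff hg_lip u (s • d)
    rw [inner_smul_right, norm_smul, Real.norm_eq_abs, abs_of_pos hs] at h
    have : s * Lg * (s / 2 * ‖d‖ ^ 2) ≤ 1 * (s / 2 * ‖d‖ ^ 2) := by gcongr
    linarith
  have hy := hstep y (-g' y)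
  rw [smul_neg, ← sub_eq_add_neg, inner_neg_right, real_inner_self_eq_norm_sq, norm_neg] at hy
  have hx := hstep x (g' y - g' x)
  have htangent := hg_convex.add_inner_gradient_le (hg_diff y) (x + s • (g' y - g' x))
  have hsplit : ⟪g' y, x + s • (g' y - g' x) - y⟫
      = s * ⟪g' y, g' y - g' x⟫ - ⟪g' y, y - x⟫ := by
    simp only [inner_sub_right, inner_add_right, inner_smul_right]
    ring
  have hnorm : ‖g' y - g' x‖ ^ 2 = ⟪g' y, g' y - g' x⟫ - ⟪g' x, g' y - g' x⟫ := by
    rw [← inner_sub_left, real_inner_self_eq_norm_sq]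
  have hscaled := congrArg (s * ·) hnorm
  simp only [mul_sub] at hscaled
  linarith
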